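/- Let Z ∈ SO(3) and let (T_t) be a sequence in SO(3) satisfying T_{t+1} = T_t · Z · T_t⁻¹ · Z⁻¹ for all t. If the rotation angle of Z is at most π/3, then T_t converges to the identity matrix as t → ∞. -/

import Mathlib

open Matrix Filter Real

/-- rotation matrix of a quaternion -/
def rotQ (a b c d : ℝ) : Matrix (Fin 3) (Fin 3) ℝ :=
  !![a^2+b^2-c^2-d^2, 2*(b*c-a*d), 2*(b*d+a*c);
     2*(b*c+a*d), a^2-b^2+c^2-d^2, 2*(c*d-a*b);
     2*(b*d-a*c), 2*(c*d+a*b), a^2-b^2-c^2+d^2]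

lemma rotQ_mul (a b c d e f g h : ℝ) : rotQ a b c d * rotQ e f g h =
    rotQ (a*e-b*f-c*g-d*h) (a*f+b*e+c*h-d*g) (a*g-b*h+c*e+d*f) (a*h+b*g-c*f+d*e) := by
  ext i j
  fin_cases i <;> fin_cases j <;> simp [rotQ, Matrix.mul_apply, Fin.sum_univ_three] <;> ring

lemma rotQ_transpose (a b c d : ℝ) : (rotQ a b c d)ᵀ = rotQ a (-b) (-c) (-d) := by
  ext i j
  fin_cases i <;> fin_cases j <;> simp [rotQ] <;> ring

lemma rotQ_trace (a b c d : ℝ) : (rotQ a b c d).trace = 3*a^2-b^2-c^2-d^2 := by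
  simp [rotQ, Matrix.trace, Fin.sum_univ_three]; ring

lemma adj_eq (R : Matrix (Fin 3) (Fin 3) ℝ) (h : Rᵀ * R = 1) (hd : R.det = 1) :
    R.adjugate = Rᵀ := by
  calc R.adjugate = Rᵀ * R * R.adjugate := by rw [h, one_mul]
    _ = Rᵀ := by rw [mul_assoc, Matrix.mul_adjugate, hd, one_smul, mul_one]

/-- four times the outer product of the quaternion with itself -/
def outerQ (R : Matrix (Fin 3) (Fin 3) ℝ) : Matrix (Fin 4) (Fin 4) ℝ :=
  !![1 + R 0 0 + R 1 1 + R 2 2, R 2 1 - R 1 2, R 0 2 - R 2 0, R 1 0 - R 0 1;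
     R 2 1 - R 1 2, 1 + R 0 0 - R 1 1 - R 2 2, R 0 1 + R 1 0, R 0 2 + R 2 0;
     R 0 2 - R 2 0, R 0 1 + R 1 0, 1 - R 0 0 + R 1 1 - R 2 2, R 1 2 + R 2 1;
     R 1 0 - R 0 1, R 0 2 + R 2 0, R 1 2 + R 2 1, 1 - R 0 0 - R 1 1 + R 2 2]

set_option maxHeartbeats 4000000 in
lemma outerQ_rank (R : Matrix (Fin 3) (Fin 3) ℝ) (h : Rᵀ * R = 1) (hd : R.det = 1)
    (a b c : Fin 4) : outerQ R a b * outerQ R a c = outerQ R a a * outerQ R b c := by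
  have hh : R * Rᵀ = 1 := mul_eq_one_comm.mp h
  have hadj := adj_eq R h hd
  rw [Matrix.adjugate_fin_three] at hadj
  have A := fun i j => congrFun (congrFun hadj i) j
  have B := fun i j => congrFun (congrFun h i) j
  have C := fun i j => congrFun (congrFun hh i) j
  have A00 := A 0 0
  have A01 := A 0 1
  have A02 := A 0 2
  have A10 := A 1 0
  have A11 := A 1 1
  have A12 := A 1 2
  have A20 := A 2 0
  have A21 := A 2 1
  have A22 := A 2 2
  have B00 := B 0 0
  have B01 := B 0 1
  have B02 := B 0 2
  have B11 := B 1 1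
  have B12 := B 1 2
  have B22 := B 2 2
  have C00 := C 0 0
  have C01 := C 0 1
  have C02 := C 0 2
  have C11 := C 1 1
  have C12 := C 1 2
  have C22 := C 2 2
  clear A B C hadj h hh hd
  simp [Matrix.mul_apply, Fin.sum_univ_three] at *
  fin_cases a <;> fin_cases b <;> fin_cases c <;> simp [outerQ] <;> linarith

lemma exists_quat (R : Matrix (Fin 3) (Fin 3) ℝ) (h : Rᵀ * R = 1) (hd : R.det = 1) :
    ∃ a b c d : ℝ, a^2+b^2+c^2+d^2 = 1 ∧ R = rotQ a b c d := by
  have hpos : ∃ k, 0 < outerQ R k k := by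
    by_contra! hc
    have h0 := hc 0
    have h1 := hc 1
    have h2 := hc 2
    have h3 := hc 3
    simp [outerQ] at h0 h1 h2 h3
    linarith
  obtain ⟨k, hk⟩ := hpos
  have hr := outerQ_rank R h hd k
  obtain ⟨q, hq⟩ : ∃ q : Fin 4 → ℝ, ∀ b c, 4 * (q b * q c) = outerQ R b c := by
    refine ⟨fun b => outerQ R k b / (2 * √(outerQ R k k)), fun b c => ?_⟩
    have hs := Real.sq_sqrt hk.le
    have hs0 := Real.sqrt_pos.mpr hk
    have : 4 * (outerQ R k b / (2 * √(outerQ R k k)) * (outerQ R k c / (2 * √(outerQ R k k))))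
        = outerQ R k b * outerQ R k c / (√(outerQ R k k))^2 := by
      field_simp
      ring
    rw [this, hs, hr b c]
    field_simp
  have q00 := hq 0 0
  have q01 := hq 0 1
  have q02 := hq 0 2
  have q03 := hq 0 3
  have q11 := hq 1 1
  have q12 := hq 1 2
  have q13 := hq 1 3
  have q22 := hq 2 2
  have q23 := hq 2 3
  have q33 := hq 3 3
  simp [outerQ] at q00 q01 q02 q03 q11 q12 q13 q22 q23 q33
  refine ⟨q 0, q 1, q 2, q 3, by linarith, ?_⟩
  ext i j
  fin_cases i <;> fin_cases j <;> simp [rotQ] <;> linarith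

lemma step_bound (T Z : Matrix (Fin 3) (Fin 3) ℝ) (hT : Tᵀ * T = 1) (hTd : T.det = 1)
    (hZ : Zᵀ * Z = 1) (hZd : Z.det = 1) (hz : 2 ≤ Z.trace) :
    3 - (T * Z * T⁻¹ * Z⁻¹).trace ≤ (3 - T.trace) - (3 - T.trace)^2 / 16 := by
  rw [Matrix.inv_eq_left_inv hT, Matrix.inv_eq_left_inv hZ]
  obtain ⟨a, u1, u2, u3, hu, rfl⟩ := exists_quat T hT hTd
  obtain ⟨c, v1, v2, v3, hv, rfl⟩ := exists_quat Z hZ hZd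
  rw [rotQ_trace] at hz
  have hvv : v1^2+v2^2+v3^2 ≤ 1/4 := by linarith
  obtain ⟨p, hp⟩ : ∃ p, p = (u2*v3-u3*v2)^2+(u3*v1-u1*v3)^2+(u1*v2-u2*v1)^2 := ⟨_, rfl⟩
  have htr : 3 - (rotQ a u1 u2 u3 * rotQ c v1 v2 v3 * (rotQ a u1 u2 u3)ᵀ
      * (rotQ c v1 v2 v3)ᵀ).trace = 16 * p * (1 - p) := by
    rw [rotQ_transpose, rotQ_transpose, rotQ_mul, rotQ_mul, rotQ_mul, rotQ_trace]
    set A := (a*c-u1*v1-u2*v2-u3*v3) with hA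
    set B := (a*v1+u1*c+u2*v3-u3*v2) with hB
    set C := (a*v2-u1*v3+u2*c+u3*v1) with hC
    set D := (a*v3+u1*v2-u2*v1+u3*c) with hD
    have n1 : A^2+B^2+C^2+D^2 = 1 := by
      have : A^2+B^2+C^2+D^2 = (a^2+u1^2+u2^2+u3^2)*(c^2+v1^2+v2^2+v3^2) := by
        rw [hA, hB, hC, hD]; ring
      rw [this, hu, hv, one_mul]
    set Ax := (A*a-B*(-u1)-C*(-u2)-D*(-u3)) with hAx
    set Bx := (A*(-u1)+B*a+C*(-u3)-D*(-u2)) with hBx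
    set Cx := (A*(-u2)-B*(-u3)+C*a+D*(-u1)) with hCx
    set Dx := (A*(-u3)+B*(-u2)-C*(-u1)+D*a) with hDx
    have n2 : Ax^2+Bx^2+Cx^2+Dx^2 = 1 := by
      have : Ax^2+Bx^2+Cx^2+Dx^2 = (A^2+B^2+C^2+D^2)*(a^2+u1^2+u2^2+u3^2) := by
        rw [hAx, hBx, hCx, hDx]; ring
      rw [this, hu, n1, one_mul]
    set Ay := (Ax*c-Bx*(-v1)-Cx*(-v2)-Dx*(-v3)) with hAy
    set By := (Ax*(-v1)+Bx*c+Cx*(-v3)-Dx*(-v2)) with hBy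
    set Cy := (Ax*(-v2)-Bx*(-v3)+Cx*c+Dx*(-v1)) with hCy
    set Dy := (Ax*(-v3)+Bx*(-v2)-Cx*(-v1)+Dx*c) with hDy
    have n3 : Ay^2+By^2+Cy^2+Dy^2 = 1 := by
      have : Ay^2+By^2+Cy^2+Dy^2 = (Ax^2+Bx^2+Cx^2+Dx^2)*(c^2+v1^2+v2^2+v3^2) := by
        rw [hAy, hBy, hCy, hDy]; ring
      rw [this, hv, n2, one_mul]
    have key : Ay = 1 - 2 * p := by
      have : Ay = (a^2+u1^2+u2^2+u3^2)*(c^2+v1^2+v2^2+v3^2) - 2 * p := by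
        rw [hAy, hAx, hBx, hCx, hDx, hA, hB, hC, hD, hp]; ring
      rw [this, hu, hv, one_mul]
    have : 3 - (3*Ay^2-By^2-Cy^2-Dy^2) = 4 - 4 * Ay^2 := by linarith
    rw [this, key]; ring
  rw [htr, rotQ_trace]
  obtain ⟨s, hs⟩ : ∃ s, s = u1^2+u2^2+u3^2 := ⟨_, rfl⟩
  have hs1 : 3 - (3*a^2-u1^2-u2^2-u3^2) = 4 * s := by linarith
  rw [hs1]
  have hs0 : 0 ≤ s := by rw [hs]; positivity
  have hsle : s ≤ 1 := by nlinarith [sq_nonneg a]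
  have hps : p ≤ s / 4 := by
    have h1 : p = s * (v1^2+v2^2+v3^2) - (u1*v1+u2*v2+u3*v3)^2 := by rw [hp, hs]; ring
    nlinarith [sq_nonneg (u1*v1+u2*v2+u3*v3), mul_le_mul_of_nonneg_left hvv hs0]
  nlinarith [mul_nonneg (sub_nonneg.mpr hps) (by linarith : 0 ≤ 1 - p - s/4)]

lemma sum_sq (T : Matrix (Fin 3) (Fin 3) ℝ) (hT : Tᵀ * T = 1) :
    ∑ i, ∑ j, (T i j - (1 : Matrix (Fin 3) (Fin 3) ℝ) i j)^2 = 2 * (3 - T.trace) := by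
  have B := fun i j => congrFun (congrFun hT i) j
  have B00 := B 0 0
  have B11 := B 1 1
  have B22 := B 2 2
  clear B
  simp [Matrix.mul_apply, Fin.sum_univ_three] at B00 B11 B22
  simp [Matrix.trace, Fin.sum_univ_three, Matrix.one_apply]
  linarith

lemma entry_bound (T : Matrix (Fin 3) (Fin 3) ℝ) (hT : Tᵀ * T = 1) (i j : Fin 3) :
    (T i j - (1 : Matrix (Fin 3) (Fin 3) ℝ) i j)^2 ≤ 2 * (3 - T.trace) := by
  rw [← sum_sq T hT]
  refine le_trans ?_ (Finset.single_le_sum (f := fun i => ∑ j, (T i j -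
    (1 : Matrix (Fin 3) (Fin 3) ℝ) i j)^2) (fun i _ => by positivity) (Finset.mem_univ i))
  exact Finset.single_le_sum (f := fun j => (T i j -
    (1 : Matrix (Fin 3) (Fin 3) ℝ) i j)^2) (fun i _ => by positivity) (Finset.mem_univ j)

lemma seq_tendsto (s : ℕ → ℝ) (h0 : ∀ t, 0 ≤ s t)
    (h : ∀ t, s (t+1) ≤ s t - (s t)^2 / 16) : Tendsto s atTop (nhds 0) := by
  have hanti : Antitone s := antitone_nat_of_succ_le fun t => by
    nlinarith [h t, sq_nonneg (s t)]
  have hl := tendsto_atTop_ciInf hanti ⟨0, by rintro _ ⟨t, rfl⟩; exact h0 t⟩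
  set L := ⨅ i, s i
  have h1 : Tendsto (fun t => s (t+1)) atTop (nhds L) := hl.comp (tendsto_add_atTop_nat 1)
  have h2 : Tendsto (fun t => s t - (s t)^2/16) atTop (nhds (L - L^2/16)) :=
    hl.sub ((hl.pow 2).div_const 16)
  have h3 := le_of_tendsto_of_tendsto' h1 h2 h
  have h4 : L = 0 := by
    have : L^2 = 0 := le_antisymm (by linarith) (sq_nonneg L)
    exact pow_eq_zero_iff (two_ne_zero) |>.mp this
  rwa [h4] at hl

/-- For `Z ∈ SO(3)` with rotation angle at most π/3 (where the
angle `θ ∈ [0, π]` satisfies `trace Z = 1 + 2 cos θ`), the commutator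
iteration `T (t+1) = T t * Z * (T t)⁻¹ * Z⁻¹` in SO(3) converges to the
identity. -/
theorem stmt_7 (Z : Matrix (Fin 3) (Fin 3) ℝ)
    (hZorth : Zᵀ * Z = 1) (hZdet : Z.det = 1)
    (θ : ℝ) (hθ0 : 0 ≤ θ) (hθπ : θ ≤ π)
    (htrace : Z.trace = 1 + 2 * Real.cos θ)
    (hangle : θ ≤ π / 3)
    (T : ℕ → Matrix (Fin 3) (Fin 3) ℝ)
    (hTorth : ∀ t, (T t)ᵀ * T t = 1) (hTdet : ∀ t, (T t).det = 1)
    (hrec : ∀ t, T (t + 1) = T t * Z * (T t)⁻¹ * Z⁻¹) :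
    Tendsto T atTop (nhds 1) := by
  have hcos : 1 / 2 ≤ Real.cos θ := by
    rw [← Real.cos_pi_div_three]
    exact Real.cos_le_cos_of_nonneg_of_le_pi hθ0 (by linarith [Real.pi_pos]) hangle
  have hz : 2 ≤ Z.trace := by linarith
  have hs := seq_tendsto (fun t => 3 - (T t).trace)
    (fun t => by
      have := entry_bound (T t) (hTorth t) 0 0
      have h2 := sq_nonneg (T t 0 0 - (1 : Matrix (Fin 3) (Fin 3) ℝ) 0 0)
      linarith)
    (fun t => by
      have := step_bound (T t) Z (hTorth t) (hTdet t) hZorth hZdet hz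
      rw [← hrec t] at this
      exact this)
  refine tendsto_pi_nhds.mpr fun i => tendsto_pi_nhds.mpr fun j => ?_
  have h2 : Tendsto (fun t => √(2 * (3 - (T t).trace))) atTop (nhds 0) := by
    have := (hs.const_mul 2).sqrt
    simpa using this
  rw [tendsto_iff_dist_tendsto_zero]
  refine squeeze_zero (fun _ => dist_nonneg) (fun t => ?_) h2
  rw [Real.dist_eq]
  exact Real.abs_le_sqrt (entry_bound (T t) (hTorth t) i j)
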